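/- Fix an odd integer k > 11 not divisible by 11 and a real ε ∈ (0,1). For every δ > 0 there is N such that for all n ≥ N the following holds: if U_0, U_1, ..., U_{10} are pairwise disjoint subsets of [n] with n(1−ε)/(11k) < |U_i| < n(1+ε)/(11k) for each i, U = U_0 ∪ ... ∪ U_{10}, W = [n] \ U, and R = U \ U_0, then for every set A of graphs on the vertex set W ∪ R, |P[G_n|_{W∪R} ∈ A and U_r(G_n) = U_r for all r = 0,...,10] − P[G_{W∪R} ∈ A] · P[U_r(G_n) = U_r for all r = 0,...,10]| ≤ δ · P[G_{W∪R} ∈ A] · P[U_r(G_n) = U_r for all r = 0,...,10]. -/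

import Mathlib

/-- The degree of a vertex in a (possibly non-decidable) simple graph. -/
noncomputable def ndeg {V : Type*} (G : SimpleGraph V) (v : V) : ℕ :=
  Nat.card (G.neighborSet v)

/-- The probability that a uniformly random graph on the (finite) vertex type `V`
belongs to the set `A`. -/
noncomputable def gprob {V : Type*} (A : Set (SimpleGraph V)) : ℝ :=
  (Nat.card A : ℝ) / 2 ^ (Nat.card V).choose 2

/-- `U(G)`: the set of vertices of `G` whose degree is divisible by `k`. -/
def divisorSet {n : ℕ} (k : ℕ) (G : SimpleGraph (Fin n)) : Set (Fin n) :=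
  {v | k ∣ ndeg G v}

/-- `U_r(G)`: the set of vertices of `U(G)` whose degree in the induced subgraph `G|_{U(G)}`
is congruent to `r` modulo 11. -/
noncomputable def residueSet {n : ℕ} (k : ℕ) (r : ℕ) (G : SimpleGraph (Fin n)) : Set (Fin n) :=
  {v | ∃ h : v ∈ divisorSet k G, ndeg (G.induce (divisorSet k G)) ⟨v, h⟩ % 11 = r}

lemma stdAddChar_sum {ι : Type*} {N : ℕ} [NeZero N] (s : Finset ι) (f : ι → ZMod N) :
    ZMod.stdAddChar (∑ i ∈ s, f i) = ∏ i ∈ s, ZMod.stdAddChar (f i) := by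
  classical
  induction s using Finset.induction_on with
  | empty => simp
  | insert i s hi ih => rw [Finset.sum_insert hi, Finset.prod_insert hi, AddChar.map_add_eq_mul, ih]

/-- Orthogonality of the additive characters of `V → ZMod N`. -/
lemma sum_stdAddChar_dotProduct {V : Type*} [Fintype V] [DecidableEq V] {N : ℕ} [NeZero N]
    (y : V → ZMod N) :
    ∑ a : V → ZMod N, ZMod.stdAddChar (a ⬝ᵥ y) =
      if y = 0 then (N : ℂ) ^ Fintype.card V else 0 := by
  have h1 : ∀ a : V → ZMod N, ZMod.stdAddChar (a ⬝ᵥ y) =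
      ∏ v, ZMod.stdAddChar (a v * y v) := fun a => by
    rw [dotProduct, stdAddChar_sum]
  have h2 := Finset.prod_univ_sum (fun _ : V => (Finset.univ : Finset (ZMod N)))
    (fun v t => ZMod.stdAddChar (t * y v))
  rw [Fintype.piFinset_univ] at h2
  simp_rw [h1]
  rw [← h2]
  simp_rw [AddChar.sum_mulShift _ (ZMod.isPrimitive_stdAddChar N), ZMod.card]
  split_ifs with hy
  · simp [hy]
  · obtain ⟨v, hv⟩ := Function.ne_iff.mp hy
    exact Finset.prod_eq_zero (Finset.mem_univ v) <| by
      rw [if_neg (by simpa using hv), Nat.cast_zero]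

/-- Fourier expansion of the number of subfamilies of `E` with prescribed sum. -/
lemma card_subset_sum_eq {V ι : Type*} [Fintype V] [DecidableEq V] {N : ℕ} [NeZero N]
    (E : Finset ι) (x : ι → V → ZMod N) (τ : V → ZMod N) :
    (N : ℂ) ^ Fintype.card V * (E.powerset.filter fun S => ∑ e ∈ S, x e = τ).card =
      ∑ a : V → ZMod N, ZMod.stdAddChar (-(a ⬝ᵥ τ)) *
        ∏ e ∈ E, (1 + ZMod.stdAddChar (a ⬝ᵥ x e)) := by
  have key : ∀ (a : V → ZMod N) (S : Finset ι),
      ZMod.stdAddChar (-(a ⬝ᵥ τ)) * ∏ e ∈ S, ZMod.stdAddChar (a ⬝ᵥ x e) =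
        ZMod.stdAddChar (a ⬝ᵥ (∑ e ∈ S, x e - τ)) := fun a S => by
    rw [← stdAddChar_sum, ← AddChar.map_add_eq_mul, dotProduct_sub, dotProduct_sum]
    congr 1
    ring
  simp_rw [Finset.prod_one_add, Finset.mul_sum, key]
  rw [Finset.sum_comm]
  simp_rw [sum_stdAddChar_dotProduct, sub_eq_zero]
  rw [← Finset.sum_filter, Finset.sum_const, nsmul_eq_mul, mul_comm]

lemma exists_norm_one_add_stdAddChar_le (N : ℕ) [NeZero N] :
    ∃ ρ : ℝ, 0 ≤ ρ ∧ ρ < 1 ∧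
      ∀ t : ZMod N, t ≠ 0 → ‖1 + (ZMod.stdAddChar t : ℂ)‖ ≤ 2 * ρ := by
  have hlt : ∀ t : ZMod N, t ≠ 0 → ‖1 + (ZMod.stdAddChar t : ℂ)‖ < 2 := by
    intro t ht
    have hn : ‖(ZMod.stdAddChar t : ℂ)‖ = 1 := AddChar.norm_apply _ _
    have hle := norm_add_le (1 : ℂ) (ZMod.stdAddChar t)
    rw [norm_one, hn] at hle
    refine lt_of_le_of_ne (by linarith) fun h => ht ?_
    have h1 : (1 : ℂ) = ZMod.stdAddChar t :=
      eq_of_norm_eq_of_norm_add_eq (by simp [hn]) (by rw [h, norm_one, hn]; norm_num)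
    apply ZMod.injective_stdAddChar
    rw [← h1, AddChar.map_zero_eq_one]
  have hne : (Finset.univ : Finset (ZMod N)).Nonempty := Finset.univ_nonempty
  let f : ZMod N → ℝ := fun t => if t = 0 then 0 else ‖1 + (ZMod.stdAddChar t : ℂ)‖ / 2
  obtain ⟨m, -, hm⟩ := Finset.exists_max_image Finset.univ f hne
  refine ⟨f m, ?_, ?_, fun t ht => ?_⟩
  · simp only [f]; split_ifs <;> positivity
  · simp only [f]; split_ifs with h
    · norm_num
    · linarith [hlt m h]
  · have := hm t (Finset.mem_univ t)
    simp only [f, if_neg ht] at this ⊢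
    linarith

/-- If every nonzero character is nontrivial on many elements of `E`, then the subfamily sums of
`E` are almost equidistributed. -/
lemma abs_card_subset_sum_sub_le {V ι : Type*} [Fintype V] [DecidableEq V] {N : ℕ} [NeZero N]
    {ρ : ℝ} (hρ0 : 0 ≤ ρ) (hρ1 : ρ ≤ 1)
    (hρ : ∀ t : ZMod N, t ≠ 0 → ‖1 + (ZMod.stdAddChar t : ℂ)‖ ≤ 2 * ρ)
    (E : Finset ι) (x : ι → V → ZMod N) (L : ℕ)
    (hL : ∀ a : V → ZMod N, (Finset.univ.filter fun v => a v ≠ 0).card * L ≤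
      (E.filter fun e => a ⬝ᵥ x e ≠ 0).card) (τ : V → ZMod N) :
    |(N : ℝ) ^ Fintype.card V * (E.powerset.filter fun S => ∑ e ∈ S, x e = τ).card
        - 2 ^ E.card| ≤
      ((1 + N * ρ ^ L) ^ Fintype.card V - 1) * 2 ^ E.card := by
  have hF := card_subset_sum_eq E x τ
  rw [← Finset.add_sum_erase _ _ (Finset.mem_univ 0)] at hF
  have h0 : (ZMod.stdAddChar (-((0 : V → ZMod N) ⬝ᵥ τ)) : ℂ) *
      ∏ e ∈ E, (1 + ZMod.stdAddChar ((0 : V → ZMod N) ⬝ᵥ x e)) = 2 ^ E.card := by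
    simp only [zero_dotProduct, neg_zero, AddChar.map_zero_eq_one, Finset.prod_const]
    norm_num
  rw [h0, ← sub_eq_iff_eq_add'] at hF
  have hterm : ∀ a : V → ZMod N, ‖(ZMod.stdAddChar (-(a ⬝ᵥ τ)) : ℂ) *
        ∏ e ∈ E, (1 + ZMod.stdAddChar (a ⬝ᵥ x e))‖ ≤
      2 ^ E.card * ∏ v, (if a v = 0 then 1 else ρ ^ L) := by
    intro a
    rw [norm_mul, AddChar.norm_apply, one_mul, norm_prod]
    calc ∏ e ∈ E, ‖1 + (ZMod.stdAddChar (a ⬝ᵥ x e) : ℂ)‖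
        ≤ ∏ e ∈ E, 2 * (if a ⬝ᵥ x e ≠ 0 then ρ else 1) := by
          refine Finset.prod_le_prod (fun _ _ => norm_nonneg _) fun e _ => ?_
          split_ifs with h
          · exact hρ _ h
          · push Not at h
            rw [h, AddChar.map_zero_eq_one]
            norm_num
      _ = 2 ^ E.card * ρ ^ (E.filter fun e => a ⬝ᵥ x e ≠ 0).card := by
          rw [Finset.prod_mul_distrib, Finset.prod_const, Finset.prod_ite]
          simp
      _ ≤ 2 ^ E.card * ρ ^ ((Finset.univ.filter fun v => a v ≠ 0).card * L) := by
          gcongr 2 ^ E.card * ?_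
          exact pow_le_pow_of_le_one hρ0 hρ1 (hL a)
      _ = 2 ^ E.card * ∏ v, (if a v = 0 then 1 else ρ ^ L) := by
          rw [Finset.prod_ite]
          simp [pow_mul']
  have hsum : ∑ a : V → ZMod N, ∏ v, (if a v = 0 then (1 : ℝ) else ρ ^ L) ≤
      (1 + N * ρ ^ L) ^ Fintype.card V := by
    have h2 := Finset.prod_univ_sum (fun _ : V => (Finset.univ : Finset (ZMod N)))
      (fun _ t => if t = 0 then (1 : ℝ) else ρ ^ L)
    rw [Fintype.piFinset_univ] at h2
    rw [← h2, Finset.prod_const, Finset.card_univ]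
    refine pow_le_pow_left₀ (Finset.sum_nonneg fun t _ => by split_ifs <;> positivity) ?_ _
    rw [← Finset.add_sum_erase _ _ (Finset.mem_univ 0), if_pos rfl]
    gcongr
    calc ∑ t ∈ Finset.univ.erase (0 : ZMod N), (if t = 0 then (1 : ℝ) else ρ ^ L)
        = ∑ t ∈ Finset.univ.erase (0 : ZMod N), ρ ^ L :=
          Finset.sum_congr rfl fun t ht => if_neg (Finset.ne_of_mem_erase ht)
      _ ≤ ∑ t : ZMod N, ρ ^ L :=
          Finset.sum_le_sum_of_subset_of_nonneg (Finset.erase_subset _ _)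
            fun _ _ _ => by positivity
      _ = N * ρ ^ L := by simp [ZMod.card]
  have hnorm : ‖(((N : ℝ) ^ Fintype.card V *
      (E.powerset.filter fun S => ∑ e ∈ S, x e = τ).card - 2 ^ E.card : ℝ) : ℂ)‖ ≤
      ∑ a ∈ Finset.univ.erase (0 : V → ZMod N),
        2 ^ E.card * ∏ v, (if a v = 0 then (1 : ℝ) else ρ ^ L) := by
    push_cast
    rw [hF]
    exact norm_sum_le_of_le _ fun a _ => hterm a
  rw [Complex.norm_real, Real.norm_eq_abs] at hnorm
  refine hnorm.trans ?_
  rw [← Finset.mul_sum, mul_comm]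
  gcongr
  rw [← Finset.add_sum_erase _ _ (Finset.mem_univ 0)] at hsum
  simp only [Pi.zero_apply, if_true, Finset.prod_const_one] at hsum
  linarith

lemma abs_card_subset_sum_mem_sub_le {V ι : Type*} [Fintype V] [DecidableEq V] {N : ℕ} [NeZero N]
    (E : Finset ι) (x : ι → V → ZMod N) {η : ℝ}
    (hη : ∀ τ : V → ZMod N, |(N : ℝ) ^ Fintype.card V *
      (E.powerset.filter fun S => ∑ e ∈ S, x e = τ).card - 2 ^ E.card| ≤ η * 2 ^ E.card)
    (T : Finset (V → ZMod N)) (h : V → ZMod N) :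
    |(N : ℝ) ^ Fintype.card V * (E.powerset.filter fun S => h + ∑ e ∈ S, x e ∈ T).card
      - T.card * 2 ^ E.card| ≤ η * (T.card * 2 ^ E.card) := by
  have hcard : (E.powerset.filter fun S => h + ∑ e ∈ S, x e ∈ T).card =
      ∑ t ∈ T, (E.powerset.filter fun S => ∑ e ∈ S, x e = t - h).card := by
    refine (Finset.card_eq_sum_card_fiberwise (f := fun S => h + ∑ e ∈ S, x e) (t := T)
      (fun S hS => (Finset.mem_filter.mp hS).2)).trans ?_
    refine Finset.sum_congr rfl fun t ht => congrArg Finset.card ?_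
    ext S
    simp only [Finset.mem_filter, eq_sub_iff_add_eq', and_assoc]
    constructor
    · rintro ⟨h1, -, h3⟩; exact ⟨h1, h3⟩
    · rintro ⟨h1, h3⟩; exact ⟨h1, h3 ▸ ht, h3⟩
  rw [hcard, Nat.cast_sum, Finset.mul_sum, ← nsmul_eq_mul, ← Finset.sum_const,
    ← Finset.sum_sub_distrib]
  refine (Finset.abs_sum_le_sum_abs _ _).trans ((Finset.sum_le_sum fun t _ => hη (t - h)).trans ?_)
  rw [Finset.sum_const, Finset.sum_const, nsmul_eq_mul, nsmul_eq_mul]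
  exact le_of_eq (by ring)

/-- The contribution of an edge `uv` to the degree of `u`, where edges leaving `U` are weighted
by `g` at their endpoint in `U`. -/
noncomputable def edgeWeight {V : Type*} [DecidableEq V] {N : ℕ} (U : Finset V) (g : ZMod N)
    (u v : V) : ZMod N :=
  if u ∈ U ∧ v ∉ U then g else 1

/-- The contribution of an edge to the vector of weighted degrees. -/
noncomputable def edgeVec {V : Type*} [DecidableEq V] {N : ℕ} (U : Finset V) (g : ZMod N)
    (p : V × V) : V → ZMod N :=
  Pi.single p.1 (edgeWeight U g p.1 p.2) + Pi.single p.2 (edgeWeight U g p.2 p.1)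

/-- The pairs `u < v` meeting `Z`. -/
def pairsMeeting {V : Type*} [Fintype V] [LinearOrder V] (Z : Finset V) : Finset (V × V) :=
  Finset.univ.filter fun p => p.1 < p.2 ∧ (p.1 ∈ Z ∨ p.2 ∈ Z)

lemma card_filter_ne_eq_two_mul {V : Type*} [Fintype V] [LinearOrder V] (P : V → V → Prop)
    [DecidableRel P] (hP : ∀ u v, P u v → P v u) :
    (Finset.univ.filter fun p : V × V => p.1 ≠ p.2 ∧ P p.1 p.2).card =
      2 * (Finset.univ.filter fun p : V × V => p.1 < p.2 ∧ P p.1 p.2).card := by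
  have h1 : (Finset.univ.filter fun p : V × V => p.1 ≠ p.2 ∧ P p.1 p.2) =
      (Finset.univ.filter fun p : V × V => p.1 < p.2 ∧ P p.1 p.2) ∪
      (Finset.univ.filter fun p : V × V => p.2 < p.1 ∧ P p.1 p.2) := by
    ext p
    simp only [Finset.mem_filter, Finset.mem_univ, true_and, Finset.mem_union, ne_iff_lt_or_gt,
      or_and_right]
  have h2 : (Finset.univ.filter fun p : V × V => p.2 < p.1 ∧ P p.1 p.2).card =
      (Finset.univ.filter fun p : V × V => p.1 < p.2 ∧ P p.1 p.2).card := by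
    refine Finset.card_nbij' Prod.swap Prod.swap ?_ ?_ (fun _ _ => rfl) (fun _ _ => rfl)
    all_goals
      intro p hp
      simp only [Finset.coe_filter, Finset.mem_univ, true_and, Set.mem_ofPred_eq, Prod.fst_swap,
        Prod.snd_swap] at hp ⊢
      exact ⟨hp.1, hP _ _ hp.2⟩
  rw [h1, Finset.card_union_of_disjoint, h2, two_mul]
  rw [Finset.disjoint_left]
  intro p hp hq
  simp only [Finset.mem_filter, Finset.mem_univ, true_and] at hp hq
  exact lt_asymm hp.1 hq.1

/-- In odd characteristic a function with large support has many pairs with nonzero sum. -/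
lemma card_mul_card_ne_zero_le {V : Type*} [DecidableEq V] {N : ℕ} [NeZero N] (hN : Odd N)
    (Z : Finset V) (a : V → ZMod N) :
    Z.card * (Z.filter fun v => a v ≠ 0).card ≤
      2 * ((Z ×ˢ Z).filter fun p => a p.1 + a p.2 ≠ 0).card := by
  set m : ZMod N → ℤ := fun x => (Z.filter fun v => a v = x).card with hm
  have hneg : ∀ x : ZMod N, x ≠ 0 → x ≠ -x := fun x hx h =>
    ZMod.ne_neg_self hN hx h
  have hQ : (((Z ×ˢ Z).filter fun p => a p.1 + a p.2 ≠ 0).card : ℤ) =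
      ∑ x : ZMod N, m x * (Z.card - m (-x)) := by
    have h1 : (((Z ×ˢ Z).filter fun p => a p.1 + a p.2 ≠ 0).card : ℤ) =
        ∑ u ∈ Z, ((Z.card : ℤ) - m (-(a u))) := by
      rw [Finset.card_filter, Finset.sum_product, Nat.cast_sum]
      refine Finset.sum_congr rfl fun u _ => ?_
      rw [← Finset.card_filter, eq_sub_iff_add_eq, hm]
      have := Finset.card_filter_add_card_filter_not (s := Z) (fun v => a v = -(a u))
      rw [← this]
      push_cast
      rw [add_comm]
      congr 4
      ext v
      rw [Ne, ← eq_neg_iff_add_eq_zero, eq_comm, neg_eq_iff_eq_neg]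
    rw [h1, ← Finset.sum_fiberwise_of_maps_to (g := a) (t := Finset.univ)
      (fun _ _ => Finset.mem_univ _)]
    refine Finset.sum_congr rfl fun x _ => ?_
    rw [Finset.sum_congr rfl (g := fun _ => (Z.card : ℤ) - m (-x))]
    · rw [Finset.sum_const, nsmul_eq_mul]
    · intro u hu
      rw [(Finset.mem_filter.mp hu).2]
  have hj : ((Z.filter fun v => a v ≠ 0).card : ℤ) =
      ∑ x : ZMod N, if x ≠ 0 then m x else 0 := by
    rw [Finset.card_eq_sum_card_fiberwise (f := a) (t := Finset.univ)
      (fun _ _ => Finset.mem_univ _), Nat.cast_sum]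
    refine Finset.sum_congr rfl fun x _ => ?_
    rw [Finset.filter_filter]
    split_ifs with hx
    · rw [hm]
      congr 2
      exact Finset.filter_congr fun v _ => ⟨fun h => h.2, fun h => ⟨h ▸ hx, h⟩⟩
    · push Not at hx
      rw [Nat.cast_eq_zero, Finset.card_eq_zero, Finset.filter_eq_empty_iff]
      rintro v - ⟨h1, h2⟩
      exact h1 (h2.trans hx)
  have hm0 : ∀ x, 0 ≤ m x := fun x => Nat.cast_nonneg _
  have hle : ∀ x, m x ≤ Z.card := fun x => Nat.cast_le.mpr (Finset.card_filter_le _ _)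
  have hadd : ∀ x, x ≠ 0 → m x + m (-x) ≤ Z.card := by
    intro x hx
    simp only [hm]
    rw [← Nat.cast_add, Nat.cast_le, ← Finset.card_union_of_disjoint]
    · exact Finset.card_le_card (Finset.union_subset (Finset.filter_subset _ _)
        (Finset.filter_subset _ _))
    · rw [Finset.disjoint_left]
      intro v hv hw
      exact hneg x hx ((Finset.mem_filter.mp hv).2.symm.trans (Finset.mem_filter.mp hw).2)
  have hs1 := Equiv.sum_comp (Equiv.neg (ZMod N)) fun x => m x * ((Z.card : ℤ) - m (-x))
  have hs2 := Equiv.sum_comp (Equiv.neg (ZMod N)) fun x => if x ≠ 0 then m x else 0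
  simp only [Equiv.neg_apply, neg_neg] at hs1 hs2
  have hterm : ∀ x : ZMod N, (Z.card : ℤ) * ((if x ≠ 0 then m x else 0) +
      (if -x ≠ 0 then m (-x) else 0)) ≤
      2 * (m x * (Z.card - m (-x)) + m (-x) * (Z.card - m x)) := by
    intro x
    by_cases hx : x = 0
    · subst hx
      have := mul_nonneg (hm0 0) (sub_nonneg.mpr (hle 0))
      simp only [ne_eq, not_true_eq_false, if_false, neg_zero, mul_zero, add_zero]
      linarith
    · rw [if_pos hx, if_pos (neg_ne_zero.mpr hx)]
      nlinarith [hm0 x, hm0 (-x), hadd x hx, sq_nonneg (m x - m (-x)),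
        mul_nonneg (add_nonneg (hm0 x) (hm0 (-x))) (sub_nonneg.mpr (hadd x hx))]
  have hsum := Finset.sum_le_sum fun x (_ : x ∈ (Finset.univ : Finset (ZMod N))) => hterm x
  rw [← Finset.mul_sum, ← Finset.mul_sum, Finset.sum_add_distrib, Finset.sum_add_distrib, hs1, hs2,
    ← hQ, ← hj] at hsum
  zify
  linarith

lemma dotProduct_edgeVec {V : Type*} [Fintype V] [DecidableEq V] {N : ℕ} (U : Finset V)
    (g : ZMod N) (a : V → ZMod N) (p : V × V) :
    a ⬝ᵥ edgeVec U g p =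
      a p.1 * edgeWeight U g p.1 p.2 + a p.2 * edgeWeight U g p.2 p.1 := by
  rw [edgeVec, dotProduct_add, dotProduct_single, dotProduct_single]

/-- Every nonzero character is nontrivial on many pairs meeting `Z`. -/
lemma card_support_mul_le {V : Type*} [Fintype V] [LinearOrder V] {N : ℕ} [NeZero N]
    (hN : Odd N) {U Z : Finset V} (hZU : Z ⊆ U) (g : ZMod N) {C L : ℕ} (hC : 0 < C)
    (hCZ : Fintype.card V ≤ C * Z.card) (hL : 8 * C * L + 2 ≤ Z.card) (a : V → ZMod N) :
    (Finset.univ.filter fun v => a v ≠ 0).card * L ≤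
      ((pairsMeeting Z).filter fun p => a ⬝ᵥ edgeVec U g p ≠ 0).card := by
  simp only [dotProduct_edgeVec]
  set c : V → V → ZMod N := fun u v => a u * edgeWeight U g u v + a v * edgeWeight U g v u with hc
  have hcs : ∀ u v, c u v = c v u := fun u v => add_comm _ _
  have h2 := card_filter_ne_eq_two_mul (fun u v : V => (u ∈ Z ∨ v ∈ Z) ∧ c u v ≠ 0)
    (fun u v h => ⟨h.1.symm, hcs u v ▸ h.2⟩)
  set B := (pairsMeeting Z).filter fun p => c p.1 p.2 ≠ 0 with hB
  have hB' : (Finset.univ.filter fun p : V × V =>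
      p.1 < p.2 ∧ (p.1 ∈ Z ∨ p.2 ∈ Z) ∧ c p.1 p.2 ≠ 0) = B := by
    rw [hB, pairsMeeting, Finset.filter_filter]
    simp only [and_assoc]
  rw [hB'] at h2
  have hcZ : ∀ u ∈ Z, ∀ v ∈ Z, c u v = a u + a v := fun u hu v hv => by
    simp [hc, edgeWeight, hZU hu, hZU hv]
  have hcO : ∀ u ∈ Z, ∀ v ∉ Z, a u = 0 → a v ≠ 0 → c u v ≠ 0 := fun u hu v hv h0 h1 => by
    simpa [hc, edgeWeight, h0, hZU hu] using h1
  set J := Z.filter fun v => a v ≠ 0 with hJ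
  set J' := Zᶜ.filter fun v => a v ≠ 0 with hJ'
  set O := Z.filter fun v => ¬ a v ≠ 0 with hO
  have hJO : J.card + O.card = Z.card := Finset.card_filter_add_card_filter_not _
  have hsupp : (Finset.univ.filter fun v => a v ≠ 0).card = J.card + J'.card := by
    rw [hJ, hJ', ← Finset.card_union_of_disjoint
      (Finset.disjoint_filter_filter disjoint_compl_right), ← Finset.filter_union,
      Finset.union_compl]
  have hQ := card_mul_card_ne_zero_le hN Z a
  have hQ2 : ((Z ×ˢ Z).filter fun p => a p.1 + a p.2 ≠ 0).card ≤
      ((Z ×ˢ Z).filter fun p => p.1 ≠ p.2 ∧ a p.1 + a p.2 ≠ 0).card + J.card := by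
    rw [← Finset.card_image_of_injective J (f := fun v => (v, v)) fun u v h => congrArg Prod.fst h]
    refine (Finset.card_le_card ?_).trans (Finset.card_union_le _ _)
    rintro ⟨u, v⟩ hp
    simp only [Finset.mem_filter, Finset.mem_product, Finset.mem_union, Finset.mem_image, hJ,
      Prod.mk.injEq] at hp ⊢
    by_cases huv : u = v
    · refine Or.inr ⟨u, ⟨hp.1.1, fun h0 => hp.2 ?_⟩, rfl, huv⟩
      rw [← huv, h0, add_zero]
    · exact Or.inl ⟨hp.1, huv, hp.2⟩
  have hlow : ((Z ×ˢ Z).filter fun p => p.1 ≠ p.2 ∧ a p.1 + a p.2 ≠ 0).card +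
      (O.card * J'.card + J'.card * O.card) ≤ 2 * B.card := by
    rw [← h2, ← Finset.card_product, ← Finset.card_product,
      ← Finset.card_union_of_disjoint, ← Finset.card_union_of_disjoint]
    · refine Finset.card_le_card ?_
      rintro ⟨u, v⟩ hp
      simp only [Finset.mem_union, Finset.mem_filter, Finset.mem_product, hO, hJ',
        Finset.mem_compl, Finset.mem_univ, true_and, not_not] at hp ⊢
      rcases hp with ⟨⟨hu, hv⟩, hne, h⟩ | ⟨⟨hu, h0⟩, hv, h1⟩ | ⟨⟨hv, h1⟩, hu, h0⟩
      · exact ⟨hne, Or.inl hu, by rwa [hcZ u hu v hv]⟩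
      · exact ⟨fun h => hv (h ▸ hu), Or.inl hu, hcO u hu v hv h0 h1⟩
      · exact ⟨fun h => hv (h ▸ hu), Or.inr hu, hcs v u ▸ hcO v hu u hv h0 h1⟩
    · rw [Finset.disjoint_left]
      rintro ⟨u, v⟩ hp hq
      simp only [Finset.mem_union, Finset.mem_filter, Finset.mem_product, hO, hJ',
        Finset.mem_compl] at hp hq
      tauto
    · rw [Finset.disjoint_left]
      rintro ⟨u, v⟩ hp hq
      simp only [Finset.mem_filter, Finset.mem_product, hO, hJ',
        Finset.mem_compl] at hp hq
      tauto
  have hV : J.card + J'.card ≤ Fintype.card V := hsupp ▸ Finset.card_le_univ _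
  have h4 : Z.card * J.card + 4 * (O.card * J'.card) ≤ 4 * B.card + 2 * J.card := by
    nlinarith
  rw [hsupp]
  generalize J.card = j at *
  generalize J'.card = j' at *
  generalize O.card = o at *
  generalize B.card = b at *
  generalize Z.card = s at *
  generalize Fintype.card V = n at *
  have h8 : (j + j') * (8 * C * L) ≤ 8 * C * b := by
    obtain ⟨t, rfl⟩ := Nat.exists_eq_add_of_le hL
    rcases le_total (2 * j) (8 * C * L + 2 + t) with hcase | hcase
    · have ho : 8 * C * L + 2 + t ≤ 2 * o := by omega
      have h5 : (8 * C * L + 2 + t) * j' ≤ 2 * (o * j') := by nlinarith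
      have h6 : (j + j') * (8 * C * L) ≤ 4 * b := by nlinarith
      nlinarith
    · have h5 : (8 * C * L) * j ≤ 4 * b := by nlinarith
      have h6 : j + j' ≤ C * (2 * j) := (hV.trans hCZ).trans (Nat.mul_le_mul_left C hcase)
      calc (j + j') * (8 * C * L) ≤ C * (2 * j) * (8 * C * L) := Nat.mul_le_mul_right _ h6
        _ = 2 * C * ((8 * C * L) * j) := by ring
        _ ≤ 2 * C * (4 * b) := Nat.mul_le_mul_left _ h5
        _ = 8 * C * b := by ring
  have : 0 < 8 * C := by omega
  refine Nat.le_of_mul_le_mul_left ?_ this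
  calc 8 * C * ((j + j') * L) = (j + j') * (8 * C * L) := by ring
    _ ≤ _ := h8

open Classical in
/-- The vector of degrees of `G`, where edges leaving `U` are weighted by `g` at their endpoint
in `U`. -/
noncomputable def weightedDegree {V : Type*} [Fintype V] [LinearOrder V] {N : ℕ} (U : Finset V)
    (g : ZMod N) (G : SimpleGraph V) : V → ZMod N :=
  ∑ p : V × V with p.1 < p.2 ∧ G.Adj p.1 p.2, edgeVec U g p

open Classical in
lemma weightedDegree_apply {V : Type*} [Fintype V] [LinearOrder V] {N : ℕ} (U : Finset V)
    (g : ZMod N) (G : SimpleGraph V) (v : V) :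
    weightedDegree U g G v = ∑ u with G.Adj v u, edgeWeight U g v u := by
  rw [weightedDegree, Finset.sum_apply, Finset.sum_filter, Finset.sum_filter]
  have h1 : ∀ p : V × V, (if p.1 < p.2 ∧ G.Adj p.1 p.2 then edgeVec U g p v else 0) =
      (if p.1 = v then (if v < p.2 ∧ G.Adj v p.2 then edgeWeight U g v p.2 else 0) else 0) +
      (if p.2 = v then (if p.1 < v ∧ G.Adj v p.1 then edgeWeight U g v p.1 else 0) else 0) := by
    rintro ⟨a, b⟩
    simp only [edgeVec, Pi.add_apply, Pi.single_apply, eq_comm (a := v)]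
    by_cases ha : a = v <;> by_cases hb : b = v <;> simp [ha, hb, G.adj_comm]
  simp_rw [h1]
  rw [Finset.sum_add_distrib, Fintype.sum_prod_type, Fintype.sum_prod_type_right]
  simp only [Finset.sum_ite_irrel, Finset.sum_const_zero, Finset.sum_ite_eq', Finset.mem_univ,
    if_true]
  rw [← Finset.sum_add_distrib]
  refine Finset.sum_congr rfl fun u _ => ?_
  rcases lt_trichotomy u v with h | h | h
  · simp [h, h.not_gt]
  · simp [h]
  · simp [h, h.not_gt]

open Classical in
lemma ndeg_eq_card_filter {V : Type*} [Fintype V] (G : SimpleGraph V) (v : V) :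
    ndeg G v = (Finset.univ.filter fun u => G.Adj v u).card := by
  rw [ndeg, Nat.card_eq_fintype_card, Fintype.card_subtype]
  rfl

open Classical in
lemma ndeg_induce_eq_card_filter {V : Type*} [Fintype V] (G : SimpleGraph V) (D : Set V) (v : V)
    (h : v ∈ D) :
    ndeg (G.induce D) ⟨v, h⟩ = (Finset.univ.filter fun u => G.Adj v u ∧ u ∈ D).card := by
  rw [ndeg_eq_card_filter, ← Finset.card_map (Function.Embedding.subtype (· ∈ D))]
  congr 1
  ext u
  simp [and_comm]

section ChineseRemainder

variable {n k : ℕ} (hcop : Nat.Coprime 11 k)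

/-- The residue vectors of weighted degrees that encode `∀ r, residueSet k r G = U r`. -/
def IsTarget (U : Fin 11 → Set (Fin n)) (t : Fin n → ZMod (11 * k)) : Prop :=
  ∀ v, (∀ i, v ∈ U i → ZMod.chineseRemainder hcop (t v) = (((i : ℕ) : ZMod 11), 0)) ∧
    ((∀ i, v ∉ U i) → (ZMod.chineseRemainder hcop (t v)).2 ≠ 0)

/-- The idempotent of `ZMod (11 * k)` that vanishes modulo `11`. -/
noncomputable def crtIdempotent : ZMod (11 * k) := (ZMod.chineseRemainder hcop).symm (0, 1)

lemma chineseRemainder_weightedDegree_snd (U : Finset (Fin n)) (G : SimpleGraph (Fin n))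
    (v : Fin n) :
    (ZMod.chineseRemainder hcop (weightedDegree U (crtIdempotent hcop) G v)).2 =
      (ndeg G v : ZMod k) := by
  classical
  rw [weightedDegree_apply, map_sum, Prod.snd_sum, ndeg_eq_card_filter, Finset.card_eq_sum_ones,
    Nat.cast_sum]
  refine Finset.sum_congr (by congr) fun u _ => ?_
  rw [edgeWeight, crtIdempotent]
  split_ifs <;> simp

open Classical in
lemma chineseRemainder_weightedDegree_fst (U : Finset (Fin n)) (G : SimpleGraph (Fin n))
    {v : Fin n} (hv : v ∈ U) :
    (ZMod.chineseRemainder hcop (weightedDegree U (crtIdempotent hcop) G v)).1 =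
      ((Finset.univ.filter fun u => G.Adj v u ∧ u ∈ U).card : ZMod 11) := by
  rw [weightedDegree_apply, map_sum, Prod.fst_sum, ← Finset.filter_filter, Finset.card_filter,
    Nat.cast_sum]
  refine Finset.sum_congr rfl fun u _ => ?_
  by_cases hu : u ∈ U <;> simp [edgeWeight, crtIdempotent, hu, hv]

open Classical in
lemma residueSet_eq_iff_isTarget (U : Fin 11 → Set (Fin n)) (G : SimpleGraph (Fin n)) :
    (∀ r : Fin 11, residueSet k (r : ℕ) G = U r) ↔
      IsTarget hcop U (weightedDegree (⋃ i, U i).toFinset (crtIdempotent hcop) G) := by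
  have hmem : ∀ v, v ∈ divisorSet k G ↔ (ndeg G v : ZMod k) = 0 := fun v =>
    (ZMod.natCast_eq_zero_iff _ _).symm
  have hmod : ∀ (d : ℕ) (i : Fin 11), d % 11 = i ↔ (d : ZMod 11) = ((i : ℕ) : ZMod 11) :=
    fun d i => by
      rw [ZMod.natCast_eq_natCast_iff', Nat.mod_eq_of_lt i.isLt]
  have hfst : divisorSet k G = ⋃ i, U i → ∀ v ∈ ⋃ i, U i, ∀ h : v ∈ divisorSet k G,
      (ZMod.chineseRemainder hcop
        (weightedDegree (⋃ i, U i).toFinset (crtIdempotent hcop) G v)).1 =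
      (ndeg (G.induce (divisorSet k G)) ⟨v, h⟩ : ZMod 11) := fun hD v hv h => by
    rw [chineseRemainder_weightedDegree_fst hcop _ _ (Set.mem_toFinset.mpr hv),
      ndeg_induce_eq_card_filter]
    simp only [Set.mem_toFinset, hD]
  constructor
  · intro hr
    have hD : divisorSet k G = ⋃ i, U i := by
      ext v
      rw [Set.mem_iUnion]
      constructor
      · intro h
        refine ⟨⟨ndeg (G.induce (divisorSet k G)) ⟨v, h⟩ % 11, Nat.mod_lt _ (by norm_num)⟩, ?_⟩
        rw [← hr]
        exact ⟨h, rfl⟩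
      · rintro ⟨i, hi⟩
        rw [← hr] at hi
        exact hi.1
    refine fun v => ⟨fun i hi => ?_, fun hv => ?_⟩
    · have hvU : v ∈ ⋃ i, U i := Set.mem_iUnion.mpr ⟨i, hi⟩
      rw [← hr] at hi
      obtain ⟨h, h11⟩ := hi
      refine Prod.ext ?_ ?_
      · rw [hfst hD v hvU h]
        exact (hmod _ i).mp h11
      · rw [chineseRemainder_weightedDegree_snd]
        exact (hmem v).mp h
    · rw [chineseRemainder_weightedDegree_snd, Ne, ← hmem, hD, Set.mem_iUnion]
      exact not_exists.mpr hv
  · intro ht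
    have hD : divisorSet k G = ⋃ i, U i := by
      ext v
      rw [hmem, ← chineseRemainder_weightedDegree_snd hcop (⋃ i, U i).toFinset, Set.mem_iUnion]
      constructor
      · intro h
        by_contra hv
        exact (ht v).2 (not_exists.mp hv) h
      · rintro ⟨i, hi⟩
        rw [(ht v).1 i hi]
    have hres : ∀ v i, v ∈ U i → ∀ h : v ∈ divisorSet k G,
        ndeg (G.induce (divisorSet k G)) ⟨v, h⟩ % 11 = i := fun v i hi h => by
      rw [hmod, ← hfst hD v (hD ▸ h) h, (ht v).1 i hi]
    intro r
    ext v
    constructor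
    · rintro ⟨h, h11⟩
      obtain ⟨i, hi⟩ := Set.mem_iUnion.mp (hD ▸ h)
      rwa [Fin.ext (h11.symm.trans (hres v i hi h))]
    · intro hv
      have h : v ∈ divisorSet k G := hD ▸ Set.mem_iUnion.mpr ⟨r, hv⟩
      exact ⟨h, hres v r hv h⟩

end ChineseRemainder

open Classical in
lemma ncard_setOf_eq_card_filter {α : Type*} [Fintype α] (P : α → Prop) :
    {x | P x}.ncard = (Finset.univ.filter P).card := by
  rw [← Set.ncard_coe_finset]
  simp

lemma spanningCoe_adj_iff {V : Type*} {Y : Set V} (H : SimpleGraph Y) (u v : V) :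
    H.spanningCoe.Adj u v ↔ ∃ (hu : u ∈ Y) (hv : v ∈ Y), H.Adj ⟨u, hu⟩ ⟨v, hv⟩ := by
  simp [SimpleGraph.map_adj]

open Classical in
/-- Graphs with prescribed restriction to the complement of `Z` correspond to sets of pairs
meeting `Z`. -/
lemma ncard_induce_eq {V : Type*} [Fintype V] [LinearOrder V] {N : ℕ} (U Z : Finset V)
    (g : ZMod N) (T : Finset (V → ZMod N)) {Y : Set V} (hY : Y = (Z : Set V)ᶜ)
    (H : SimpleGraph Y) :
    {G : SimpleGraph V | weightedDegree U g G ∈ T ∧ G.induce Y = H}.ncard =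
      ((pairsMeeting Z).powerset.filter fun S =>
        weightedDegree U g H.spanningCoe + ∑ p ∈ S, edgeVec U g p ∈ T).card := by
  rw [ncard_setOf_eq_card_filter]
  have hYm : ∀ v, v ∈ Y ↔ v ∉ Z := fun v => by rw [hY]; simp
  have hpm : ∀ u v, (u, v) ∈ pairsMeeting Z ↔ u < v ∧ (u ∈ Z ∨ v ∈ Z) := fun u v => by
    simp [pairsMeeting]
  have hdeg : ∀ G : SimpleGraph V, G.induce Y = H → weightedDegree U g G =
      weightedDegree U g H.spanningCoe +
        ∑ p ∈ (pairsMeeting Z).filter (fun p => G.Adj p.1 p.2), edgeVec U g p := by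
    rintro G rfl
    rw [weightedDegree, weightedDegree, ← Finset.sum_union]
    · refine Finset.sum_congr ?_ fun _ _ => rfl
      ext ⟨u, v⟩
      simp only [Finset.mem_filter, Finset.mem_univ, true_and, Finset.mem_union, hpm,
        spanningCoe_adj_iff, hYm, SimpleGraph.comap_adj, Function.Embedding.subtype_apply]
      by_cases hu : u ∈ Z <;> by_cases hv : v ∈ Z <;> simp [hu, hv]
    · rw [Finset.disjoint_left]
      rintro ⟨u, v⟩ hp hq
      simp only [Finset.mem_filter, Finset.mem_univ, true_and, hpm,
        spanningCoe_adj_iff, hYm] at hp hq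
      obtain ⟨-, hu, hv, -⟩ := hp
      exact hq.1.2.elim hu hv
  obtain ⟨ext, hext⟩ : ∃ ext : Finset (V × V) → SimpleGraph V, ext = fun S =>
    SimpleGraph.fromRel fun u v => H.spanningCoe.Adj u v ∨ (u, v) ∈ S := ⟨_, rfl⟩
  have hind : ∀ S ⊆ pairsMeeting Z, (ext S).induce Y = H := by
    intro S hS
    ext ⟨u, hu⟩ ⟨v, hv⟩
    have h1 : (u, v) ∉ S := fun h => ((hpm _ _).mp (hS h)).2.elim ((hYm u).mp hu) ((hYm v).mp hv)
    have h2 : (v, u) ∉ S := fun h => ((hpm _ _).mp (hS h)).2.elim ((hYm v).mp hv) ((hYm u).mp hu)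
    simp only [hext, SimpleGraph.comap_adj, SimpleGraph.fromRel_adj, spanningCoe_adj_iff,
      Function.Embedding.subtype_apply, h1, h2, or_false]
    constructor
    · rintro ⟨-, ⟨_, _, h⟩ | ⟨_, _, h⟩⟩
      exacts [h, h.symm]
    · exact fun h => ⟨fun huv => h.ne (Subtype.ext huv), Or.inl ⟨hu, hv, h⟩⟩
  have hfil : ∀ S ⊆ pairsMeeting Z,
      (pairsMeeting Z).filter (fun p => (ext S).Adj p.1 p.2) = S := by
    intro S hS
    ext ⟨u, v⟩
    simp only [Finset.mem_filter, hext, SimpleGraph.fromRel_adj, spanningCoe_adj_iff, hYm]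
    constructor
    · rintro ⟨hp, -, (⟨hu, hv, -⟩ | h) | (⟨hv, hu, -⟩ | h)⟩
      · exact (((hpm u v).mp hp).2.elim hu hv).elim
      · exact h
      · exact (((hpm u v).mp hp).2.elim hu hv).elim
      · exact (lt_asymm ((hpm u v).mp hp).1 ((hpm v u).mp (hS h)).1).elim
    · exact fun h => ⟨hS h, ((hpm u v).mp (hS h)).1.ne, Or.inl (Or.inr h)⟩
  have hleft : ∀ G : SimpleGraph V, G.induce Y = H →
      ext ((pairsMeeting Z).filter fun p => G.Adj p.1 p.2) = G := by
    rintro G rfl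
    ext u v
    simp only [hext, SimpleGraph.fromRel_adj, spanningCoe_adj_iff, Finset.mem_filter, hpm, hYm,
      SimpleGraph.comap_adj, Function.Embedding.subtype_apply]
    constructor
    · rintro ⟨-, (⟨_, _, h⟩ | ⟨_, h⟩) | (⟨_, _, h⟩ | ⟨_, h⟩)⟩
      exacts [h, h, h.symm, h.symm]
    · intro h
      refine ⟨h.ne, ?_⟩
      by_cases hZ : u ∈ Z ∨ v ∈ Z
      · rcases h.ne.lt_or_gt with hlt | hlt
        · exact Or.inl (Or.inr ⟨⟨hlt, hZ⟩, h⟩)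
        · exact Or.inr (Or.inr ⟨⟨hlt, hZ.symm⟩, h.symm⟩)
      · push Not at hZ
        exact Or.inl (Or.inl ⟨hZ.1, hZ.2, h⟩)
  refine Finset.card_nbij' (fun G => (pairsMeeting Z).filter fun p => G.Adj p.1 p.2) ext
    ?_ ?_ ?_ ?_
  · intro G hG
    simp only [Finset.coe_filter, Finset.mem_univ, true_and, Set.mem_ofPred_eq,
      Finset.mem_powerset] at hG ⊢
    exact ⟨Finset.filter_subset _ _, hdeg G hG.2 ▸ hG.1⟩
  · intro S hS
    simp only [Finset.coe_filter, Finset.mem_univ, true_and, Set.mem_ofPred_eq,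
      Finset.mem_powerset] at hS ⊢
    refine ⟨?_, hind S hS.1⟩
    rw [hdeg _ (hind S hS.1), hfil S hS.1]
    exact hS.2
  · intro G hG
    simp only [Finset.coe_filter, Finset.mem_univ, true_and, Set.mem_ofPred_eq] at hG
    exact hleft G hG.2
  · intro S hS
    simp only [Finset.coe_filter, Set.mem_ofPred_eq, Finset.mem_powerset] at hS
    exact hfil S hS.1

lemma card_simpleGraph (V : Type*) [Finite V] :
    Nat.card (SimpleGraph V) = 2 ^ (Nat.card V).choose 2 := by
  classical
  have := Fintype.ofFinite V
  let e : SimpleGraph V ≃ Set (⊤ : SimpleGraph V).edgeSet :=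
    { toFun := fun G => {x | x.1 ∈ G.edgeSet}
      invFun := fun S => SimpleGraph.fromEdgeSet (Subtype.val '' S)
      left_inv := fun G => by
        ext u v
        simp
      right_inv := fun S => by
        ext ⟨x, hx⟩
        have hd : ¬ x.IsDiag := by simpa using hx
        simp [hd] }
  rw [Nat.card_congr e, Nat.card_eq_fintype_card, Nat.card_eq_fintype_card, Fintype.card_set,
    SimpleGraph.card_edgeSet, SimpleGraph.card_edgeFinset_top_eq_card_choose_two]

lemma gprob_eq_ncard_div {V : Type*} [Finite V] (A : Set (SimpleGraph V)) :
    gprob A = A.ncard / Nat.card (SimpleGraph V) := by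
  rw [gprob, Nat.card_coe_set_eq, card_simpleGraph]
  norm_cast

lemma abs_sub_le_of_close {a f c M D SA SF η δ : ℝ} (ha : 0 ≤ a) (hf : 0 < f) (hc : 0 < c)
    (hD : 0 < D) (hδ : 0 < δ) (hη : η = δ / (2 + δ))
    (hA : |c * SA - a * M| ≤ η * (a * M)) (hF : |c * SF - f * M| ≤ η * (f * M)) :
    |SA / D - a / f * (SF / D)| ≤ δ * (a / f * (SF / D)) := by
  have h2 : 2 * η = δ * (1 - η) := by rw [hη]; field_simp; ring
  have hF' : |c * (a / f * SF) - a * M| ≤ η * (a * M) := by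
    have : c * (a / f * SF) - a * M = a / f * (c * SF - f * M) := by field_simp
    rw [this, abs_mul, abs_of_nonneg (by positivity)]
    calc a / f * |c * SF - f * M| ≤ a / f * (η * (f * M)) := by gcongr
      _ = η * (a * M) := by field_simp
  have key : c * |SA - a / f * SF| ≤ c * (δ * (a / f * SF)) := by
    rw [← abs_of_pos hc, ← abs_mul, abs_of_pos hc, mul_sub, abs_le]
    rw [abs_le] at hA hF'
    have h3 : δ * ((1 - η) * (a * M)) ≤ δ * (c * (a / f * SF)) := by
      refine mul_le_mul_of_nonneg_left ?_ hδ.le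
      linarith [hF'.1]
    have h4 : δ * ((1 - η) * (a * M)) = 2 * (η * (a * M)) := by linear_combination -(a * M) * h2
    have h5 : c * (δ * (a / f * SF)) = δ * (c * (a / f * SF)) := by ring
    constructor <;> linarith [hA.1, hA.2, hF'.1, hF'.2]
  have key' := le_of_mul_le_mul_left key hc
  have e1 : SA / D - a / f * (SF / D) = (SA - a / f * SF) / D := by ring
  have e2 : δ * (a / f * (SF / D)) = δ * (a / f * SF) / D := by ring
  rw [e1, e2, abs_div, abs_of_pos hD]
  gcongr

lemma exists_forall_one_add_mul_pow_sub_one_le {ρ η K : ℝ} (hρ0 : 0 ≤ ρ) (hρ1 : ρ < 1)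
    (hη : 0 < η) (hK : 0 ≤ K) {C : ℕ} (hC : 0 < C) :
    ∃ n₀ : ℕ, ∀ n ≥ n₀, ∀ s : ℕ, n ≤ C * s →
      ∃ L : ℕ, 8 * C * L + 2 ≤ s ∧ (1 + K * ρ ^ L) ^ n - 1 ≤ η := by
  have ht : Filter.Tendsto (fun L : ℕ => 10 * (C : ℝ) ^ 2 * K * (L * ρ ^ L + ρ ^ L))
      Filter.atTop (nhds 0) := by
    simpa using ((tendsto_self_mul_const_pow_of_lt_one hρ0 hρ1).add
      (tendsto_pow_atTop_nhds_zero_of_lt_one hρ0 hρ1)).const_mul (10 * (C : ℝ) ^ 2 * K)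
  have hlog : 0 < Real.log (1 + η) := Real.log_pos (by linarith)
  obtain ⟨L₀, hL₀⟩ := Filter.eventually_atTop.mp (ht.eventually_le_const hlog)
  refine ⟨C * (8 * C * L₀ + 2), fun n hn s hs => ?_⟩
  have hs2 : 8 * C * L₀ + 2 ≤ s := Nat.le_of_mul_le_mul_left (hn.trans hs) hC
  have hC8 : 0 < 8 * C := by omega
  set L := (s - 2) / (8 * C) with hL
  have hL0 : L₀ ≤ L := (Nat.le_div_iff_mul_le hC8).mpr (by rw [mul_comm]; omega)
  have hle : 8 * C * L ≤ s - 2 := Nat.mul_div_le _ _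
  have hlt : s - 2 < 8 * C * (L + 1) := Nat.lt_mul_div_succ _ hC8
  have hs3 : s ≤ 10 * C * (L + 1) := by
    have : 1 ≤ C * (L + 1) := Nat.mul_pos hC (Nat.succ_pos L)
    have h8 : 8 * C * (L + 1) = 8 * (C * (L + 1)) := by ring
    have h10 : 10 * C * (L + 1) = 10 * (C * (L + 1)) := by ring
    omega
  refine ⟨L, by omega, ?_⟩
  have hn' : (n : ℝ) ≤ 10 * (C : ℝ) ^ 2 * (L + 1) := by
    have : n ≤ C * (10 * C * (L + 1)) := hs.trans (Nat.mul_le_mul_left C hs3)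
    calc (n : ℝ) ≤ ((C * (10 * C * (L + 1)) : ℕ) : ℝ) := Nat.cast_le.mpr this
      _ = 10 * (C : ℝ) ^ 2 * (L + 1) := by push_cast; ring
  have hx : 0 ≤ K * ρ ^ L := by positivity
  have hexp : (1 + K * ρ ^ L) ^ n ≤ 1 + η := by
    calc (1 + K * ρ ^ L) ^ n ≤ Real.exp (K * ρ ^ L) ^ n := by
          gcongr
          rw [add_comm]
          exact Real.add_one_le_exp _
      _ = Real.exp (n * (K * ρ ^ L)) := (Real.exp_nat_mul _ _).symm
      _ ≤ Real.exp (Real.log (1 + η)) := by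
          gcongr
          calc (n : ℝ) * (K * ρ ^ L) ≤ 10 * (C : ℝ) ^ 2 * (L + 1) * (K * ρ ^ L) := by gcongr
            _ = 10 * (C : ℝ) ^ 2 * K * (L * ρ ^ L + ρ ^ L) := by ring
            _ ≤ _ := hL₀ L hL0
      _ = 1 + η := Real.exp_log (by linarith)
  linarith

open Classical in
lemma ncard_induce_mem_eq_sum {V : Type*} [Fintype V] {Y : Set V}
    (B : Set (SimpleGraph Y)) (P : SimpleGraph V → Prop) :
    {G : SimpleGraph V | G.induce Y ∈ B ∧ P G}.ncard =
      ∑ H ∈ B.toFinset, {G : SimpleGraph V | P G ∧ G.induce Y = H}.ncard := by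
  simp only [ncard_setOf_eq_card_filter]
  rw [Finset.card_eq_sum_card_fiberwise (f := fun G : SimpleGraph V => G.induce Y)
    (t := B.toFinset)]
  · refine Finset.sum_congr rfl fun H hH => congrArg Finset.card ?_
    rw [Set.mem_toFinset] at hH
    ext G
    simp only [Finset.mem_filter, Finset.mem_univ, true_and]
    constructor
    · rintro ⟨⟨-, h⟩, rfl⟩; exact ⟨h, rfl⟩
    · rintro ⟨h, rfl⟩; exact ⟨⟨hH, h⟩, rfl⟩
  · intro G hG
    simp only [Finset.coe_filter, Finset.mem_univ, true_and, Set.mem_ofPred_eq,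
      Set.coe_toFinset] at hG ⊢
    exact hG.1

/-- If every `H` has almost the same number of extensions satisfying `P`, then `P` is almost
independent of the induced subgraph. -/
lemma abs_gprob_sub_le {V : Type*} [Fintype V] {Y : Set V} (P : SimpleGraph V → Prop)
    {c M δ : ℝ} (hc : 0 < c) (hδ : 0 < δ)
    (hX : ∀ H : SimpleGraph Y,
      |c * {G : SimpleGraph V | P G ∧ G.induce Y = H}.ncard - M| ≤ δ / (2 + δ) * M)
    (A : Set (SimpleGraph Y)) :
    |gprob {G : SimpleGraph V | G.induce Y ∈ A ∧ P G} - gprob A * gprob {G : SimpleGraph V | P G}|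
      ≤ δ * (gprob A * gprob {G : SimpleGraph V | P G}) := by
  classical
  have hsum : ∀ B : Set (SimpleGraph Y),
      |c * ({G : SimpleGraph V | G.induce Y ∈ B ∧ P G}.ncard : ℝ) - B.ncard * M| ≤
      δ / (2 + δ) * (B.ncard * M) := fun B => by
    rw [ncard_induce_mem_eq_sum, Nat.cast_sum, Finset.mul_sum, ← nsmul_eq_mul,
      Set.ncard_eq_toFinset_card' B, ← Finset.sum_const, ← Finset.sum_sub_distrib, Finset.mul_sum]
    exact (Finset.abs_sum_le_sum_abs _ _).trans (Finset.sum_le_sum fun H _ => hX H)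
  have hU := hsum Set.univ
  simp only [Set.mem_univ, true_and, Set.ncard_univ] at hU
  simp only [gprob_eq_ncard_div]
  exact abs_sub_le_of_close (Nat.cast_nonneg _) (Nat.cast_pos.mpr Nat.card_pos) hc
    (Nat.cast_pos.mpr Nat.card_pos) hδ rfl (hsum A) hU

lemma abs_gprob_residueSet_sub_le {n k : ℕ} (hcop : Nat.Coprime 11 k) (hodd : Odd k)
    [NeZero (11 * k)] {ρ δ : ℝ} (hρ0 : 0 ≤ ρ) (hρ1 : ρ ≤ 1)
    (hρ : ∀ t : ZMod (11 * k), t ≠ 0 → ‖1 + (ZMod.stdAddChar t : ℂ)‖ ≤ 2 * ρ)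
    (hδ : 0 < δ) {C L : ℕ} (hC : 0 < C) (U : Fin 11 → Set (Fin n))
    (hCU : n ≤ C * (U 0).ncard) (hL : 8 * C * L + 2 ≤ (U 0).ncard)
    (hη : (1 + ((11 * k : ℕ) : ℝ) * ρ ^ L) ^ n - 1 ≤ δ / (2 + δ)) {Y : Set (Fin n)}
    (hY : Y = (U 0)ᶜ) (A : Set (SimpleGraph Y)) :
    |gprob {G : SimpleGraph (Fin n) |
        G.induce Y ∈ A ∧ ∀ r : Fin 11, residueSet k (r : ℕ) G = U r}
      - gprob A * gprob {G : SimpleGraph (Fin n) | ∀ r : Fin 11, residueSet k (r : ℕ) G = U r}|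
    ≤ δ * (gprob A *
        gprob {G : SimpleGraph (Fin n) | ∀ r : Fin 11, residueSet k (r : ℕ) G = U r}) := by
  classical
  have hN : Odd (11 * k) := Odd.mul (by decide) hodd
  set Z := (U 0).toFinset with hZ
  set W := (⋃ i, U i).toFinset with hW
  have hZW : Z ⊆ W := Set.toFinset_subset_toFinset.mpr (Set.subset_iUnion U 0)
  have hZc : (U 0).ncard = Z.card := Set.ncard_eq_toFinset_card' _
  rw [hZc] at hCU hL
  set g : ZMod (11 * k) := crtIdempotent hcop
  set T : Finset (Fin n → ZMod (11 * k)) := Finset.univ.filter (IsTarget hcop U) with hT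
  refine abs_gprob_sub_le (fun G => ∀ r : Fin 11, residueSet k (r : ℕ) G = U r)
    (c := ((11 * k : ℕ) : ℝ) ^ Fintype.card (Fin n))
    (M := T.card * 2 ^ (pairsMeeting Z).card)
    (pow_pos (Nat.cast_pos.mpr (NeZero.pos (11 * k))) _) hδ (fun H => ?_) A
  have hiff : ∀ G : SimpleGraph (Fin n), (∀ r : Fin 11, residueSet k (r : ℕ) G = U r) ↔
      weightedDegree W g G ∈ T := fun G => by
    rw [residueSet_eq_iff_isTarget hcop, hT, Finset.mem_filter]
    simp [g, hW]
  simp only [hiff]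
  rw [ncard_induce_eq W Z g T (by rw [hY, hZ, Set.coe_toFinset]) H]
  convert abs_card_subset_sum_mem_sub_le (pairsMeeting Z) (edgeVec W g) (fun τ => ?_) T
    (weightedDegree W g H.spanningCoe) using 1
  refine (abs_card_subset_sum_sub_le hρ0 hρ1 hρ (pairsMeeting Z) (edgeVec W g) L
    (card_support_mul_le hN hZW g hC (by rwa [Fintype.card_fin]) hL) τ).trans ?_
  rw [Fintype.card_fin]
  gcongr

/-- Conditioned on `U_r(G_n) = U_r` for `r = 0, …, 10`, the induced subgraph `G_n|_{W ∪ R}` is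
almost uniformly distributed (part 2 of the key lemma), where `W = [n] \ U` and `R = U \ U_0`. -/
theorem induced_subgraph_almost_uniform_on_WR
    (k : ℕ) (hodd : Odd k) (hk : 11 < k) (hdvd : ¬ (11 ∣ k))
    (ε : ℝ) (hε : ε ∈ Set.Ioo (0 : ℝ) 1) (δ : ℝ) (hδ : 0 < δ) :
    ∃ N : ℕ, ∀ n ≥ N, ∀ U : Fin 11 → Set (Fin n),
      Pairwise (Function.onFun Disjoint U) →
      (∀ i, (n : ℝ) * (1 - ε) / (11 * k) < ((U i).ncard : ℝ) ∧
            ((U i).ncard : ℝ) < (n : ℝ) * (1 + ε) / (11 * k)) →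
      ∀ A : Set (SimpleGraph ↥((⋃ i, U i)ᶜ ∪ ((⋃ i, U i) \ U 0))),
        |gprob {G : SimpleGraph (Fin n) |
            G.induce ((⋃ i, U i)ᶜ ∪ ((⋃ i, U i) \ U 0)) ∈ A ∧
              ∀ r : Fin 11, residueSet k (r : ℕ) G = U r}
          - gprob A * gprob {G : SimpleGraph (Fin n) |
              ∀ r : Fin 11, residueSet k (r : ℕ) G = U r}|
        ≤ δ * (gprob A * gprob {G : SimpleGraph (Fin n) |
            ∀ r : Fin 11, residueSet k (r : ℕ) G = U r}) := by
  have hcop : Nat.Coprime 11 k := (Nat.Prime.coprime_iff_not_dvd (by norm_num)).mpr hdvd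
  have : NeZero (11 * k) := ⟨by omega⟩
  obtain ⟨ρ, hρ0, hρ1, hρ⟩ := exists_norm_one_add_stdAddChar_le (11 * k)
  have hε1 : 0 < 1 - ε := sub_pos.mpr hε.2
  have hk0 : (0 : ℝ) < 11 * k := by
    have : (0 : ℝ) < k := Nat.cast_pos.mpr (by omega)
    positivity
  obtain ⟨C, hC⟩ := exists_nat_gt (11 * k / (1 - ε))
  have hC0 : 0 < C := Nat.cast_pos.mp ((div_pos hk0 hε1).trans hC)
  obtain ⟨n₀, hn₀⟩ := exists_forall_one_add_mul_pow_sub_one_le hρ0 hρ1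
    (show 0 < δ / (2 + δ) by positivity) (Nat.cast_nonneg (11 * k)) hC0
  refine ⟨n₀, fun n hn U _ hU A => ?_⟩
  have hCU : n ≤ C * (U 0).ncard := by
    have h0 := (hU 0).1
    rw [div_lt_iff₀ hk0] at h0
    rw [div_lt_iff₀ hε1] at hC
    have : (n : ℝ) * (1 - ε) ≤ (C * (U 0).ncard) * (1 - ε) := by
      calc (n : ℝ) * (1 - ε) ≤ (U 0).ncard * (11 * k) := h0.le
        _ ≤ (U 0).ncard * (C * (1 - ε)) := by gcongr
        _ = (C * (U 0).ncard) * (1 - ε) := by ring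
    exact_mod_cast le_of_mul_le_mul_right this hε1
  obtain ⟨L, hL, hη⟩ := hn₀ n hn _ hCU
  refine abs_gprob_residueSet_sub_le hcop hodd hρ0 hρ1.le hρ hδ hC0 U hCU hL hη ?_ A
  ext v
  have h0 : v ∈ U 0 → v ∈ ⋃ i, U i := fun h => Set.mem_iUnion.mpr ⟨0, h⟩
  simp only [Set.mem_union, Set.mem_compl_iff, Set.mem_sdiff]
  tauto
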